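/- Let D : ℝ² → ℝ be twice continuously differentiable with D(x) > 0 for all x, and let 𝐮 : ℝ² → ℝ² be a twice continuously differentiable vector field with compact support such that ℰ(𝐮)(x) = 0 for all x ∈ ℝ², where ℰ(𝐮) = 𝐮 − (1/2)·D·∇(∇·(D𝐮)) + (1/6)·D²·∇(∇·𝐮). Then 𝐮 ≡ 0 on ℝ² (uniqueness for the elliptic boundary value problem ℰ(𝐮) = 𝐟). -/

import Mathlib

open MeasureTheory

/-- Partial derivative in the `x`-direction of a scalar function on `ℝ²`. -/
noncomputable def pdx (f : ℝ × ℝ → ℝ) (x : ℝ × ℝ) : ℝ := fderiv ℝ f x (1, 0)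

/-- Partial derivative in the `y`-direction of a scalar function on `ℝ²`. -/
noncomputable def pdy (f : ℝ × ℝ → ℝ) (x : ℝ × ℝ) : ℝ := fderiv ℝ f x (0, 1)

/-- Divergence `∇·𝐮 = ∂ₓu₁ + ∂_yu₂` of a vector field on `ℝ²`. -/
noncomputable def vdiv (u : ℝ × ℝ → ℝ × ℝ) (x : ℝ × ℝ) : ℝ :=
  pdx (fun p => (u p).1) x + pdy (fun p => (u p).2) x

/-- Gradient `∇f = (∂ₓf, ∂_yf)` of a scalar function on `ℝ²`. -/
noncomputable def grad (f : ℝ × ℝ → ℝ) (x : ℝ × ℝ) : ℝ × ℝ := (pdx f x, pdy f x)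

/-- The Peregrine elliptic operator
`ℰ(𝐮) = 𝐮 − (1/2)·D·∇(∇·(D𝐮)) + (1/6)·D²·∇(∇·𝐮)`. -/
noncomputable def Eop (D : ℝ × ℝ → ℝ) (u : ℝ × ℝ → ℝ × ℝ) (x : ℝ × ℝ) : ℝ × ℝ :=
  u x - ((1/2) * D x) • grad (vdiv (fun p => D p • u p)) x
      + ((1/6) * (D x)^2) • grad (vdiv u) x

lemma ContDiff.pdx {n : WithTop ℕ∞} {f : ℝ × ℝ → ℝ} (hf : ContDiff ℝ (n + 1) f) :
    ContDiff ℝ n (pdx f) :=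
  (hf.fderiv_right le_rfl).clm_apply contDiff_const

lemma ContDiff.pdy {n : WithTop ℕ∞} {f : ℝ × ℝ → ℝ} (hf : ContDiff ℝ (n + 1) f) :
    ContDiff ℝ n (pdy f) :=
  (hf.fderiv_right le_rfl).clm_apply contDiff_const

lemma ContDiff.vdiv {n : WithTop ℕ∞} {u : ℝ × ℝ → ℝ × ℝ} (hu : ContDiff ℝ (n + 1) u) :
    ContDiff ℝ n (vdiv u) :=
  hu.fst.pdx.add hu.snd.pdy

lemma pdx_mul {f g : ℝ × ℝ → ℝ} {x : ℝ × ℝ} (hf : DifferentiableAt ℝ f x)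
    (hg : DifferentiableAt ℝ g x) :
    pdx (fun p => f p * g p) x = f x * pdx g x + pdx f x * g x := by
  simp [pdx, fderiv_fun_mul hf hg, mul_comm]

lemma pdy_mul {f g : ℝ × ℝ → ℝ} {x : ℝ × ℝ} (hf : DifferentiableAt ℝ f x)
    (hg : DifferentiableAt ℝ g x) :
    pdy (fun p => f p * g p) x = f x * pdy g x + pdy f x * g x := by
  simp [pdy, fderiv_fun_mul hf hg, mul_comm]

lemma pdx_sub {f g : ℝ × ℝ → ℝ} {x : ℝ × ℝ} (hf : DifferentiableAt ℝ f x)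
    (hg : DifferentiableAt ℝ g x) :
    pdx (fun p => f p - g p) x = pdx f x - pdx g x := by
  simp [pdx, fderiv_fun_sub hf hg]

lemma pdy_sub {f g : ℝ × ℝ → ℝ} {x : ℝ × ℝ} (hf : DifferentiableAt ℝ f x)
    (hg : DifferentiableAt ℝ g x) :
    pdy (fun p => f p - g p) x = pdy f x - pdy g x := by
  simp [pdy, fderiv_fun_sub hf hg]

/-- Product rule `∇·(s𝐮) = s ∇·𝐮 + 𝐮·∇s`. -/
lemma vdiv_smul {s : ℝ × ℝ → ℝ} {u : ℝ × ℝ → ℝ × ℝ} {x : ℝ × ℝ}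
    (hs : DifferentiableAt ℝ s x) (hu : DifferentiableAt ℝ u x) :
    vdiv (fun p => s p • u p) x
      = s x * vdiv u x + ((u x).1 * pdx s x + (u x).2 * pdy s x) := by
  simp only [vdiv, Prod.smul_fst, Prod.smul_snd, smul_eq_mul]
  rw [pdx_mul hs hu.fst, pdy_mul hs hu.snd]
  ring

lemma integral_fderiv_apply_eq_zero {E : Type*} [NormedAddCommGroup E] [NormedSpace ℝ E]
    [FiniteDimensional ℝ E] [MeasurableSpace E] [BorelSpace E] {μ : Measure E}
    [μ.IsAddHaarMeasure] {f : E → ℝ} (hf : ContDiff ℝ 1 f) (hc : HasCompactSupport f) (v : E) :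
    ∫ x, fderiv ℝ f x v ∂μ = 0 := by
  have hi : Integrable (fun x => fderiv ℝ f x v) μ :=
    ((hf.continuous_fderiv one_ne_zero).clm_apply continuous_const).integrable_of_hasCompactSupport
      (hc.fderiv_apply ℝ v)
  have h := integral_mul_fderiv_eq_neg_fderiv_mul_of_integrable (μ := μ) (v := v)
    (f := fun _ => (1 : ℝ)) (g := f) (by simp) (by simpa using hi)
    (by simpa using hf.continuous.integrable_of_hasCompactSupport hc)
    (fun _ _ => differentiableAt_const _)
    (fun x _ => hf.differentiable one_ne_zero x)
  simpa using h

lemma HasCompactSupport.vdiv {u : ℝ × ℝ → ℝ × ℝ} (hc : HasCompactSupport u) :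
    HasCompactSupport (vdiv u) :=
  ((hc.comp_left (g := Prod.fst) rfl).fderiv_apply ℝ (1, 0)).add
    ((hc.comp_left (g := Prod.snd) rfl).fderiv_apply ℝ (0, 1))

/-- Divergence theorem for compactly supported fields on `ℝ²`. -/
lemma integral_vdiv_eq_zero {u : ℝ × ℝ → ℝ × ℝ} (hu : ContDiff ℝ 1 u)
    (hc : HasCompactSupport u) : ∫ x, vdiv u x = 0 := by
  have h1 : HasCompactSupport (fun p => (u p).1) := hc.comp_left (g := Prod.fst) rfl
  have h2 : HasCompactSupport (fun p => (u p).2) := hc.comp_left (g := Prod.snd) rfl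
  unfold vdiv
  rw [integral_add]
  · simp only [pdx, pdy]
    rw [integral_fderiv_apply_eq_zero hu.fst h1, integral_fderiv_apply_eq_zero hu.snd h2, add_zero]
  · exact (ContDiff.pdx (n := 0) (by simpa using hu.fst)).continuous.integrable_of_hasCompactSupport
      (h1.fderiv_apply ℝ (1, 0))
  · exact (ContDiff.pdy (n := 0) (by simpa using hu.snd)).continuous.integrable_of_hasCompactSupport
      (h2.fderiv_apply ℝ (0, 1))

/-- A compactly supported `C¹` field with nonnegative divergence is divergence free. -/
lemma vdiv_eq_zero_of_nonneg {u : ℝ × ℝ → ℝ × ℝ} (hu : ContDiff ℝ 1 u)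
    (hc : HasCompactSupport u) (h : ∀ x, 0 ≤ vdiv u x) (x : ℝ × ℝ) : vdiv u x = 0 := by
  by_contra hx
  have hcont : Continuous (vdiv u) := (ContDiff.vdiv (n := 0) (by simpa using hu)).continuous
  exact (hcont.integral_pos_of_hasCompactSupport_nonneg_nonzero (μ := volume) hc.vdiv h hx).ne'
    (integral_vdiv_eq_zero hu hc)

/-- uniqueness for the elliptic problem — if `ℰ(𝐮) = 0` on all of `ℝ²`
for a `C²` compactly supported vector field `𝐮` and a positive `C²` depth `D`,
then `𝐮 ≡ 0`. -/
theorem uniqueness_elliptic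
    (D : ℝ × ℝ → ℝ) (hD : ContDiff ℝ 2 D) (hDpos : ∀ x, 0 < D x)
    (u : ℝ × ℝ → ℝ × ℝ) (hu : ContDiff ℝ 2 u) (hsupp : HasCompactSupport u)
    (hE : ∀ x, Eop D u x = 0) :
    ∀ x, u x = 0 := by
  have hDu : ContDiff ℝ 2 (fun p => D p • u p) := hD.smul hu
  set P := vdiv (fun p => D p • u p)
  set Q := vdiv u with hQdef
  have hP : ContDiff ℝ 1 P := ContDiff.vdiv (by simpa [one_add_one_eq_two] using hDu)
  have hQ : ContDiff ℝ 1 Q := ContDiff.vdiv (by simpa [one_add_one_eq_two] using hu)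
  have hD1 : ContDiff ℝ 1 D := hD.of_le one_le_two
  have hu1 : ContDiff ℝ 1 u := hu.of_le one_le_two
  set s : ℝ × ℝ → ℝ := fun p => D p * ((1 / 2) * P p - ((1 / 6) * D p) * Q p) with hsdef
  have hs : ContDiff ℝ 1 s := by fun_prop
  have hW (x) : vdiv (fun p => s p • u p) x = (u x).1 ^ 2 + (u x).2 ^ 2 + (1 / 3) * P x ^ 2
      + (1 / 6) * ((u x).1 * pdx D x + (u x).2 * pdy D x) ^ 2 := by
    have dD : DifferentiableAt ℝ D x := hD1.differentiable one_ne_zero x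
    have dP : DifferentiableAt ℝ P x := hP.differentiable one_ne_zero x
    have dQ : DifferentiableAt ℝ Q x := hQ.differentiable one_ne_zero x
    have du : DifferentiableAt ℝ u x := hu1.differentiable one_ne_zero x
    have hPx : P x = D x * Q x + ((u x).1 * pdx D x + (u x).2 * pdy D x) := vdiv_smul dD du
    have cx (c : ℝ) : pdx (fun _ => c) x = 0 := by simp [pdx]
    have cy (c : ℝ) : pdy (fun _ => c) x = 0 := by simp [pdy]
    have hsx : pdx s x = D x * ((1 / 2) * pdx P x - ((1 / 6) * D x * pdx Q x
        + (1 / 6) * pdx D x * Q x)) + pdx D x * ((1 / 2) * P x - ((1 / 6) * D x) * Q x) := by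
      rw [hsdef, pdx_mul dD (by fun_prop), pdx_sub (by fun_prop) (by fun_prop),
        pdx_mul (by fun_prop) dP, pdx_mul (by fun_prop) dQ, pdx_mul (by fun_prop) dD, cx, cx]
      ring
    have hsy : pdy s x = D x * ((1 / 2) * pdy P x - ((1 / 6) * D x * pdy Q x
        + (1 / 6) * pdy D x * Q x)) + pdy D x * ((1 / 2) * P x - ((1 / 6) * D x) * Q x) := by
      rw [hsdef, pdy_mul dD (by fun_prop), pdy_sub (by fun_prop) (by fun_prop),
        pdy_mul (by fun_prop) dP, pdy_mul (by fun_prop) dQ, pdy_mul (by fun_prop) dD, cy, cy]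
      ring
    have e1 : (u x).1 - (1 / 2) * D x * pdx P x + (1 / 6) * D x ^ 2 * pdx Q x = 0 :=
      congrArg Prod.fst (hE x)
    have e2 : (u x).2 - (1 / 2) * D x * pdy P x + (1 / 6) * D x ^ 2 * pdy Q x = 0 :=
      congrArg Prod.snd (hE x)
    rw [vdiv_smul (hs.differentiable one_ne_zero x) du, hsx, hsy]
    rw [← hQdef]
    simp only [hsdef, hPx]
    linear_combination (-(u x).1) * e1 - (u x).2 * e2
  intro x
  have h0 : vdiv (fun p => s p • u p) x = 0 := vdiv_eq_zero_of_nonneg (hs.smul hu1) hsupp.smul_left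
    (fun x => (hW x).symm ▸ by positivity) x
  rw [hW] at h0
  have hP0 := sq_nonneg (P x)
  have hb0 := sq_nonneg ((u x).1 * pdx D x + (u x).2 * pdy D x)
  have hx1 : (u x).1 ^ 2 = 0 := by linarith [sq_nonneg (u x).1, sq_nonneg (u x).2]
  have hx2 : (u x).2 ^ 2 = 0 := by linarith [sq_nonneg (u x).1, sq_nonneg (u x).2]
  exact Prod.ext (pow_eq_zero_iff two_ne_zero |>.1 hx1) (pow_eq_zero_iff two_ne_zero |>.1 hx2)
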